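/- There exists an absolute constant C such that for every collection T of n pairwise disjoint non-vertical triangles in ℝ³ in general position, each triangle of T can be partitioned into closed triangular pieces with pairwise disjoint relative interiors, with at most C·n³ pieces in total over all triangles, such that the depth relation on the relative interiors of the resulting pieces is acyclic. (The pieces are obtained by cutting each triangle along the boundaries of the vertical prisms erected over the faces of the arrangement, in the xy-plane, of the vertical projections of all the triangles.) -/

import Mathlib

/-- The vertical projection `ℝ³ → ℝ²` forgetting the `z`-coordinate. -/
def proj (p : Fin 3 → ℝ) : Fin 2 → ℝ := ![p 0, p 1]

/-- A (nondegenerate) triangle in `ℝ³`: the convex hull of three affinely independent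
points. -/
def IsTriangleSet (s : Set (Fin 3 → ℝ)) : Prop :=
  ∃ a b c : Fin 3 → ℝ, AffineIndependent ℝ ![a, b, c] ∧ s = convexHull ℝ {a, b, c}

/-- The depth relation: `o₁ ≺ o₂` if some vertical line meets both sets, with the
intersection with `o₁` lower (in `z`-coordinate) than the intersection with `o₂`. -/
def Below (o₁ o₂ : Set (Fin 3 → ℝ)) : Prop :=
  ∃ p ∈ o₁, ∃ q ∈ o₂, p 0 = q 0 ∧ p 1 = q 1 ∧ p 2 < q 2

/-- The depth relation on a collection `O` of pieces is acyclic. -/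
def DepthAcyclic (O : Set (Set (Fin 3 → ℝ))) : Prop :=
  ¬ ∃ (k : ℕ) (o : Fin (k + 1) → Set (Fin 3 → ℝ)),
      (∀ i, o i ∈ O) ∧ ∀ i, Below (o i) (o (i + 1))

/-- The value at `x` of the affine function with slope `l.1` and intercept `l.2`. -/
def lineEval (l : ℝ × ℝ) (x : ℝ) : ℝ := l.1 * x + l.2

/-- The height over `(x, y)` of the non-vertical plane with coefficients `π`. -/
def planeEval (π : ℝ × ℝ × ℝ) (x y : ℝ) : ℝ := π.1 * x + π.2.1 * y + π.2.2

/-- The part of the plane `π` lying over the slab `s ≤ x ≤ t` between the lines `f` and `g`. -/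
def trapezoid (π : ℝ × ℝ × ℝ) (s t : ℝ) (f g : ℝ × ℝ) : Set (Fin 3 → ℝ) :=
  {p | s ≤ p 0 ∧ p 0 ≤ t ∧ lineEval f (p 0) ≤ p 1 ∧ p 1 ≤ lineEval g (p 0) ∧
    p 2 = planeEval π (p 0) (p 1)}

/-- The line through the projections of `p` and `q`; a junk value if `p 0 = q 0`. -/
noncomputable def lineThrough (p q : Fin 3 → ℝ) : ℝ × ℝ :=
  ((q 1 - p 1) / (q 0 - p 0), p 1 - (q 1 - p 1) / (q 0 - p 0) * p 0)

lemma lineEval_lineThrough_left (p q : Fin 3 → ℝ) : lineEval (lineThrough p q) (p 0) = p 1 := by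
  simp [lineEval, lineThrough]

lemma lineEval_lineThrough_right {p q : Fin 3 → ℝ} (h : p 0 ≠ q 0) :
    lineEval (lineThrough p q) (q 0) = q 1 := by
  have : q 0 - p 0 ≠ 0 := sub_ne_zero.2 h.symm
  simp only [lineEval, lineThrough]
  field_simp
  ring

lemma mem_convexHull_triple {a b c p : Fin 3 → ℝ} :
    p ∈ convexHull ℝ {a, b, c} ↔
      ∃ α β γ : ℝ, 0 ≤ α ∧ 0 ≤ β ∧ 0 ≤ γ ∧ α + β + γ = 1 ∧
        ∀ i, p i = α * a i + β * b i + γ * c i := by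
  constructor
  · intro hp
    rw [convexHull_insert (by simp), convexHull_pair, mem_convexJoin] at hp
    obtain ⟨x, hx, y, hy, hp⟩ := hp
    rw [Set.mem_singleton_iff] at hx
    subst hx
    obtain ⟨u, v, hu, hv, huv, rfl⟩ := hy
    obtain ⟨u', v', hu', hv', huv', rfl⟩ := hp
    refine ⟨u', v' * u, v' * v, hu', by positivity, by positivity, ?_, fun i => ?_⟩
    · linear_combination huv' + v' * huv
    · simp
      ring
  · rintro ⟨α, β, γ, hα, hβ, hγ, h, hp⟩
    have hp : p = α • a + β • b + γ • c := by
      ext i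
      simp [hp]
    have := (convex_convexHull ℝ ({a, b, c} : Set (Fin 3 → ℝ))).sum_mem (t := Finset.univ)
      (w := ![α, β, γ]) (z := ![a, b, c])
      (by intro i _; fin_cases i <;> simpa) (by simpa [Fin.sum_univ_three])
      (by intro i _; apply subset_convexHull; fin_cases i <;> simp)
    simpa [hp, Fin.sum_univ_three] using this

/-- Over a slab separating the apex `a` from `b` and `c`, a triangle is the trapezoid between
the lines carrying its edges `ab` and `ac`. -/
lemma convexHull_inter_slab {π : ℝ × ℝ × ℝ} {f g : ℝ × ℝ} {a b c : Fin 3 → ℝ} {s t : ℝ}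
    (hst : s < t) (hfa : lineEval f (a 0) = a 1) (hga : lineEval g (a 0) = a 1)
    (hfb : lineEval f (b 0) = b 1) (hgc : lineEval g (c 0) = c 1)
    (ha : a 2 = planeEval π (a 0) (a 1)) (hb : b 2 = planeEval π (b 0) (b 1))
    (hc : c 2 = planeEval π (c 0) (c 1))
    (hsep : (a 0 ≤ s ∧ t ≤ b 0 ∧ t ≤ c 0) ∨ (b 0 ≤ s ∧ c 0 ≤ s ∧ t ≤ a 0))
    (hfg : ∀ x ∈ Set.Ioo s t, lineEval f x < lineEval g x) :
    convexHull ℝ {a, b, c} ∩ {p | s ≤ p 0 ∧ p 0 ≤ t} = trapezoid π s t f g := by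
  obtain ⟨f1, f0⟩ := f
  obtain ⟨g1, g0⟩ := g
  obtain ⟨π1, π2, π0⟩ := π
  have hmid := hfg ((s + t) / 2) ⟨by linarith, by linarith⟩
  simp only [lineEval, planeEval] at *
  have hM : 0 < (g1 - f1) * ((s + t) / 2 - a 0) := by linarith
  have hMb : 0 < (g1 - f1) * (b 0 - a 0) := by
    rcases hsep with h | h
    · have := (pos_iff_pos_of_mul_pos hM).2 (by linarith)
      exact mul_pos this (by linarith)
    · have := (neg_iff_neg_of_mul_pos hM).2 (by linarith)
      exact mul_pos_of_neg_of_neg this (by linarith)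
  have hMc : 0 < (g1 - f1) * (c 0 - a 0) := by
    rcases hsep with h | h
    · have := (pos_iff_pos_of_mul_pos hM).2 (by linarith)
      exact mul_pos this (by linarith)
    · have := (neg_iff_neg_of_mul_pos hM).2 (by linarith)
      exact mul_pos_of_neg_of_neg this (by linarith)
  ext p
  simp only [Set.mem_inter_iff, mem_convexHull_triple, Set.mem_ofPred_eq, trapezoid, lineEval,
    planeEval]
  constructor
  · rintro ⟨⟨α, β, γ, hα, hβ, hγ, hsum, hp⟩, hs, ht⟩
    have h1 : p 1 - (f1 * p 0 + f0) = γ * ((g1 - f1) * (c 0 - a 0)) := by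
      rw [hp, hp]
      linear_combination -α * hfa - β * hfb - γ * hgc + γ * (hga - hfa) + f0 * hsum
    have h2 : (g1 * p 0 + g0) - p 1 = β * ((g1 - f1) * (b 0 - a 0)) := by
      rw [hp, hp]
      linear_combination α * hga + γ * hgc + β * hfb - β * (hfa - hga) - g0 * hsum
    refine ⟨hs, ht, ?_, ?_, ?_⟩
    · have := mul_nonneg hγ hMc.le
      linarith
    · have := mul_nonneg hβ hMb.le
      linarith
    · rw [hp, hp, hp]
      linear_combination α * ha + β * hb + γ * hc + π0 * hsum
  · rintro ⟨hs, ht, h1, h2, h3⟩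
    have hb0 : b 0 - a 0 ≠ 0 := right_ne_zero_of_mul hMb.ne'
    have hc0 : c 0 - a 0 ≠ 0 := right_ne_zero_of_mul hMc.ne'
    have hM0 : g1 - f1 ≠ 0 := left_ne_zero_of_mul hMc.ne'
    obtain ⟨β, hβ⟩ : ∃ β, β = (g1 * p 0 + g0 - p 1) / ((g1 - f1) * (b 0 - a 0)) := ⟨_, rfl⟩
    obtain ⟨γ, hγ⟩ : ∃ γ, γ = (p 1 - (f1 * p 0 + f0)) / ((g1 - f1) * (c 0 - a 0)) := ⟨_, rfl⟩
    have hβ0 : 0 ≤ β := hβ ▸ div_nonneg (by linarith) hMb.le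
    have hγ0 : 0 ≤ γ := hγ ▸ div_nonneg (by linarith) hMc.le
    rw [eq_div_iff hMb.ne'] at hβ
    rw [eq_div_iff hMc.ne'] at hγ
    have hx : β * (b 0 - a 0) + γ * (c 0 - a 0) = p 0 - a 0 := by
      apply mul_left_cancel₀ hM0
      linear_combination hβ + hγ - hfa + hga
    have hy : β * (b 1 - a 1) + γ * (c 1 - a 1) = p 1 - a 1 := by
      linear_combination hγ - β * hfb - γ * hgc + β * hfa + γ * hga - hfa + f1 * hx
    have hle : β + γ ≤ 1 := by
      rcases hsep with ⟨h1, h2, h3⟩ | ⟨h1, h2, h3⟩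
      · have := mul_le_mul_of_nonneg_left h2 hβ0
        have := mul_le_mul_of_nonneg_left h3 hγ0
        by_contra! hcon
        have := mul_pos (sub_pos.2 hcon) (show 0 < t - a 0 by linarith)
        linarith
      · have := mul_le_mul_of_nonneg_left h1 hβ0
        have := mul_le_mul_of_nonneg_left h2 hγ0
        by_contra! hcon
        have := mul_pos (sub_pos.2 hcon) (show 0 < a 0 - s by linarith)
        linarith
    refine ⟨⟨1 - β - γ, β, γ, by linarith, hβ0, hγ0, by ring, ?_⟩, hs, ht⟩
    intro i
    fin_cases i
    · simp only [Fin.zero_eta]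
      linear_combination -hx
    · simp only [Fin.mk_one]
      linear_combination -hy
    · simp only [Fin.reduceFinMk]
      linear_combination h3 - (1 - β - γ) * ha - β * hb - γ * hc - π1 * hx - π2 * hy

lemma affineIndependent_triple {a b c : Fin 3 → ℝ}
    (h : (b 0 - a 0) * (c 1 - a 1) - (b 1 - a 1) * (c 0 - a 0) ≠ 0) :
    AffineIndependent ℝ ![a, b, c] := by
  rw [affineIndependent_iff_of_fintype]
  intro w hw hsum
  rw [Finset.univ.weightedVSub_eq_weightedVSubOfPoint_of_sum_eq_zero w _ hw (0 : Fin 3 → ℝ)] at hsum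
  simp [Finset.weightedVSubOfPoint_apply, Fin.sum_univ_three] at hsum hw
  have h0 := congrFun hsum 0
  have h1 := congrFun hsum 1
  simp at h0 h1
  have e1 : w 1 = 0 := by
    apply (mul_eq_zero.1 _).resolve_right h
    linear_combination (c 1 - a 1) * h0 - (c 0 - a 0) * h1 -
      (a 0 * (c 1 - a 1) - a 1 * (c 0 - a 0)) * hw
  have e2 : w 2 = 0 := by
    apply (mul_eq_zero.1 _).resolve_right h
    linear_combination -(b 1 - a 1) * h0 + (b 0 - a 0) * h1 +
      (a 0 * (b 1 - a 1) - a 1 * (b 0 - a 0)) * hw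
  intro i
  fin_cases i
  · simpa [e1, e2] using hw
  · exact e1
  · exact e2

/-- The projection of a non-vertical triangle is nondegenerate. -/
lemma det_ne_zero_of_nonvertical {v : Fin 3 → Fin 3 → ℝ} (hv : AffineIndependent ℝ v)
    (hz : (![0, 0, 1] : Fin 3 → ℝ) ∉
      (affineSpan ℝ ({v 0, v 1, v 2} : Set (Fin 3 → ℝ))).direction) :
    (v 1 0 - v 0 0) * (v 2 1 - v 0 1) - (v 1 1 - v 0 1) * (v 2 0 - v 0 0) ≠ 0 := by
  intro hD
  obtain ⟨l, m, hlm, h0, h1⟩ : ∃ l m : ℝ, (l ≠ 0 ∨ m ≠ 0) ∧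
      l * (v 1 0 - v 0 0) + m * (v 2 0 - v 0 0) = 0 ∧
      l * (v 1 1 - v 0 1) + m * (v 2 1 - v 0 1) = 0 := by
    by_cases hx : v 2 0 - v 0 0 ≠ 0 ∨ v 1 0 - v 0 0 ≠ 0
    · exact ⟨v 2 0 - v 0 0, -(v 1 0 - v 0 0), hx.imp_right neg_ne_zero.2, by ring,
        by linear_combination -hD⟩
    push Not at hx
    by_cases hy : v 2 1 - v 0 1 ≠ 0 ∨ v 1 1 - v 0 1 ≠ 0
    · exact ⟨v 2 1 - v 0 1, -(v 1 1 - v 0 1), hy.imp_right neg_ne_zero.2,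
        by linear_combination hD, by ring⟩
    push Not at hy
    exact ⟨1, 0, by simp, by simp [hx], by simp [hy]⟩
  by_cases hw : l * (v 1 2 - v 0 2) + m * (v 2 2 - v 0 2) = 0
  · rw [affineIndependent_iff_of_fintype] at hv
    have hsum : ∑ i, ![-(l + m), l, m] i = 0 := by simp [Fin.sum_univ_three]
    have := hv ![-(l + m), l, m] hsum (by
      rw [Finset.univ.weightedVSub_eq_weightedVSubOfPoint_of_sum_eq_zero _ _ hsum (0 : Fin 3 → ℝ)]
      ext i
      simp only [Finset.weightedVSubOfPoint_apply, Fin.sum_univ_three, vsub_eq_sub, sub_zero]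
      fin_cases i
      · simp
        linear_combination h0
      · simp
        linear_combination h1
      · simp
        linear_combination hw)
    rcases hlm with h | h
    · exact h (this 1)
    · exact h (this 2)
  · apply hz
    have key : (![0, 0, 1] : Fin 3 → ℝ) = (l * (v 1 2 - v 0 2) + m * (v 2 2 - v 0 2))⁻¹ •
        (l • (v 1 -ᵥ v 0) + m • (v 2 -ᵥ v 0)) := by
      ext i
      fin_cases i
      · simp [h0]
      · simp [h1]
      · simp [inv_mul_cancel₀ hw]
    rw [key]
    have hmem : ∀ i, v i ∈ affineSpan ℝ ({v 0, v 1, v 2} : Set (Fin 3 → ℝ)) := fun i =>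
      subset_affineSpan ℝ _ (by fin_cases i <;> simp)
    exact Submodule.smul_mem _ _ (Submodule.add_mem _
      (Submodule.smul_mem _ _ (AffineSubspace.vsub_mem_direction (hmem 1) (hmem 0)))
      (Submodule.smul_mem _ _ (AffineSubspace.vsub_mem_direction (hmem 2) (hmem 0))))

lemma exists_plane {a b c : Fin 3 → ℝ}
    (h : (b 0 - a 0) * (c 1 - a 1) - (b 1 - a 1) * (c 0 - a 0) ≠ 0) :
    ∃ π : ℝ × ℝ × ℝ, a 2 = planeEval π (a 0) (a 1) ∧ b 2 = planeEval π (b 0) (b 1) ∧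
      c 2 = planeEval π (c 0) (c 1) := by
  obtain ⟨D, hD⟩ : ∃ D, D = (b 0 - a 0) * (c 1 - a 1) - (b 1 - a 1) * (c 0 - a 0) := ⟨_, rfl⟩
  rw [← hD] at h
  obtain ⟨A, hA⟩ : ∃ A, A = ((b 2 - a 2) * (c 1 - a 1) - (c 2 - a 2) * (b 1 - a 1)) / D := ⟨_, rfl⟩
  obtain ⟨B, hB⟩ : ∃ B, B = ((b 0 - a 0) * (c 2 - a 2) - (c 0 - a 0) * (b 2 - a 2)) / D := ⟨_, rfl⟩
  rw [eq_div_iff h] at hA hB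
  refine ⟨(A, B, a 2 - A * a 0 - B * a 1), ?_, ?_, ?_⟩ <;> simp only [planeEval]
  · ring
  · apply mul_left_cancel₀ h
    linear_combination -(b 0 - a 0) * hA - (b 1 - a 1) * hB + (b 2 - a 2) * hD
  · apply mul_left_cancel₀ h
    linear_combination -(c 0 - a 0) * hA - (c 1 - a 1) * hB + (c 2 - a 2) * hD

/-- An affine function of the first two coordinates that is nonnegative but not identically zero
on `P` is positive on the relative interior of `P`. -/
lemma pos_of_mem_intrinsicInterior {P : Set (Fin 3 → ℝ)} (u v w : ℝ)
    (hl : ∀ p ∈ P, 0 ≤ u * p 0 + v * p 1 + w) {q : Fin 3 → ℝ} (hq : q ∈ P)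
    (hlq : 0 < u * q 0 + v * q 1 + w) {p : Fin 3 → ℝ} (hp : p ∈ intrinsicInterior ℝ P) :
    0 < u * p 0 + v * p 1 + w := by
  refine (hl p (intrinsicInterior_subset hp)).lt_of_ne fun h0 => ?_
  rw [mem_intrinsicInterior] at hp
  obtain ⟨y, hy, rfl⟩ := hp
  have hmem : ∀ ε : ℝ, AffineMap.lineMap (y : Fin 3 → ℝ) q ε ∈ affineSpan ℝ P := fun ε =>
    AffineMap.lineMap_mem ε y.2 (subset_affineSpan ℝ P hq)
  have hcont : Continuous fun ε : ℝ => (⟨_, hmem ε⟩ : affineSpan ℝ P) :=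
    Continuous.subtype_mk (by fun_prop) _
  have hnhds := hcont.continuousAt.preimage_mem_nhds (x := 0)
    (t := ((↑) ⁻¹' P : Set (affineSpan ℝ P))) (by simpa using mem_interior_iff_mem_nhds.1 hy)
  obtain ⟨δ, hδ, hball⟩ := Metric.mem_nhds_iff.1 hnhds
  have hδ' := hl (AffineMap.lineMap (y : Fin 3 → ℝ) q (-(δ / 2)))
    (hball (a := -(δ / 2)) (by simp [abs_of_pos hδ, hδ]))
  simp only [AffineMap.lineMap_apply, vsub_eq_sub, vadd_eq_add, Pi.add_apply, Pi.smul_apply,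
    Pi.sub_apply, smul_eq_mul] at hδ'
  have := mul_pos hδ hlq
  nlinarith

/-- An affine function that is nonnegative at the ends of `[s, t]` is nonnegative between. -/
lemma lineEval_le_of_mem_Icc {f g : ℝ × ℝ} {s t x : ℝ} (hs : lineEval f s ≤ lineEval g s)
    (ht : lineEval f t ≤ lineEval g t) (hx : x ∈ Set.Icc s t) : lineEval f x ≤ lineEval g x := by
  obtain ⟨hsx, hxt⟩ := hx
  rcases hsx.eq_or_lt with rfl | hsx
  · exact hs
  · simp only [lineEval] at *
    have h1 := mul_nonneg (sub_nonneg.2 hs) (sub_nonneg.2 hxt)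
    have h2 := mul_nonneg (sub_nonneg.2 ht) (sub_nonneg.2 hsx.le)
    by_contra! h
    have h3 := mul_pos (sub_pos.2 h) (show 0 < t - s by linarith)
    nlinarith

lemma lineEval_lt_of_mem_Ioo {f g : ℝ × ℝ} {s t x : ℝ} (hs : lineEval f s ≤ lineEval g s)
    (ht : lineEval f t ≤ lineEval g t) (h : lineEval f s < lineEval g s ∨ lineEval f t < lineEval g t)
    (hx : x ∈ Set.Ioo s t) : lineEval f x < lineEval g x := by
  obtain ⟨hsx, hxt⟩ := hx
  simp only [lineEval] at *
  by_contra! hc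
  have h3 := mul_nonneg (sub_nonneg.2 hc) (show 0 ≤ t - s by linarith)
  rcases h with h | h
  · have h1 := mul_pos (sub_pos.2 h) (sub_pos.2 hxt)
    have h2 := mul_nonneg (sub_nonneg.2 ht) (sub_nonneg.2 hsx.le)
    nlinarith
  · have h1 := mul_nonneg (sub_nonneg.2 hs) (sub_nonneg.2 hxt.le)
    have h2 := mul_pos (sub_pos.2 h) (sub_pos.2 hsx)
    nlinarith

lemma lineEval_le_ends {f g : ℝ × ℝ} {s t : ℝ} (hst : s < t)
    (h : ∀ x ∈ Set.Ioo s t, lineEval f x < lineEval g x) :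
    lineEval f s ≤ lineEval g s ∧ lineEval f t ≤ lineEval g t := by
  have hc : ∀ l : ℝ × ℝ, Continuous (lineEval l) := fun l => by unfold lineEval; fun_prop
  have hsub : Set.Icc s t ⊆ {x | lineEval f x ≤ lineEval g x} := by
    rw [← closure_Ioo hst.ne]
    exact closure_minimal (fun x hx => (h x hx).le) (isClosed_le (hc f) (hc g))
  exact ⟨hsub ⟨le_rfl, hst.le⟩, hsub ⟨hst.le, le_rfl⟩⟩

lemma isTriangleSet_trapezoid (π : ℝ × ℝ × ℝ) {f g : ℝ × ℝ} {s t : ℝ} (hst : s < t)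
    (h : (lineEval f s = lineEval g s ∧ lineEval f t < lineEval g t) ∨
      (lineEval f s < lineEval g s ∧ lineEval f t = lineEval g t)) :
    IsTriangleSet (trapezoid π s t f g) := by
  have hfg : ∀ x ∈ Set.Ioo s t, lineEval f x < lineEval g x := fun x hx =>
    lineEval_lt_of_mem_Ioo (h.elim (fun h => h.1.le) (fun h => h.1.le))
      (h.elim (fun h => h.2.le) (fun h => h.2.le)) (h.symm.imp And.left And.right) hx
  obtain ⟨u, w, heq, hlt, huw⟩ : ∃ u w, lineEval f u = lineEval g u ∧
      lineEval f w < lineEval g w ∧ ((u = s ∧ w = t) ∨ (u = t ∧ w = s)) := by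
    rcases h with h | h
    · exact ⟨s, t, h.1, h.2, Or.inl ⟨rfl, rfl⟩⟩
    · exact ⟨t, s, h.2, h.1, Or.inr ⟨rfl, rfl⟩⟩
  have hne : w - u ≠ 0 := by
    rcases huw with ⟨rfl, rfl⟩ | ⟨rfl, rfl⟩ <;> linarith
  have key := convexHull_inter_slab (π := π) (f := f) (g := g)
    (a := ![u, lineEval f u, planeEval π u (lineEval f u)])
    (b := ![w, lineEval f w, planeEval π w (lineEval f w)])
    (c := ![w, lineEval g w, planeEval π w (lineEval g w)]) hst (by simp) (by simp [heq])
    (by simp) (by simp) (by simp) (by simp) (by simp)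
    (by rcases huw with ⟨rfl, rfl⟩ | ⟨rfl, rfl⟩ <;> simp) hfg
  refine ⟨_, _, _, affineIndependent_triple ?_, key.symm.trans (Set.inter_eq_left.2 ?_)⟩
  · have := mul_ne_zero hne (sub_pos.2 hlt).ne'
    simp only [Matrix.cons_val_zero, Matrix.cons_val_one]
    intro h0
    apply this
    linear_combination h0
  · intro p hp
    obtain ⟨α, β, γ, hα, hβ, hγ, hsum, hp⟩ := mem_convexHull_triple.1 hp
    have h0 := hp 0
    simp only [Matrix.cons_val_zero] at h0
    obtain rfl : α = 1 - β - γ := by linarith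
    have h1 := mul_nonneg hα (show 0 ≤ t - s by linarith)
    have h2 := mul_nonneg (add_nonneg hβ hγ) (show 0 ≤ t - s by linarith)
    constructor
    · rcases huw with ⟨rfl, rfl⟩ | ⟨rfl, rfl⟩ <;> nlinarith
    · rcases huw with ⟨rfl, rfl⟩ | ⟨rfl, rfl⟩ <;> nlinarith

lemma intrinsicInterior_trapezoid_subset {π : ℝ × ℝ × ℝ} {f g : ℝ × ℝ} {s t : ℝ} (hst : s < t)
    (hfg : ∀ x ∈ Set.Ioo s t, lineEval f x < lineEval g x) {p : Fin 3 → ℝ}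
    (hp : p ∈ intrinsicInterior ℝ (trapezoid π s t f g)) :
    p 0 ∈ Set.Ioo s t ∧ lineEval f (p 0) < p 1 ∧ p 1 < lineEval g (p 0) := by
  have hmid := hfg ((s + t) / 2) ⟨by linarith, by linarith⟩
  obtain ⟨y, hfy, hyg⟩ := exists_between hmid
  have hq : (![(s + t) / 2, y, planeEval π ((s + t) / 2) y] : Fin 3 → ℝ) ∈
      trapezoid π s t f g := by
    refine ⟨?_, ?_, ?_, ?_, ?_⟩ <;> simp <;> linarith
  have h1 := pos_of_mem_intrinsicInterior 1 0 (-s)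
    (fun p hp => by linarith [hp.1]) hq (by simp; linarith) hp
  have h2 := pos_of_mem_intrinsicInterior (-1) 0 t
    (fun p hp => by linarith [hp.2.1]) hq (by simp; linarith) hp
  simp only [lineEval] at hfy hyg ⊢
  have h3 := pos_of_mem_intrinsicInterior (-f.1) 1 (-f.2)
    (fun p hp => by have := hp.2.2.1; simp only [lineEval] at this; linarith) hq
    (by simp; linarith) hp
  have h4 := pos_of_mem_intrinsicInterior g.1 (-1) g.2
    (fun p hp => by have := hp.2.2.2.1; simp only [lineEval] at this; linarith) hq
    (by simp; linarith) hp
  exact ⟨⟨by linarith, by linarith⟩, by linarith, by linarith⟩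

/-- The line from the point of `f` over `s` to the point of `g` over `t`. -/
noncomputable def diagonal (s t : ℝ) (f g : ℝ × ℝ) : ℝ × ℝ :=
  lineThrough ![s, lineEval f s, 0] ![t, lineEval g t, 0]

lemma lineEval_diagonal_left (s t : ℝ) (f g : ℝ × ℝ) :
    lineEval (diagonal s t f g) s = lineEval f s :=
  lineEval_lineThrough_left ![s, lineEval f s, 0] ![t, lineEval g t, 0]

lemma lineEval_diagonal_right {s t : ℝ} (hst : s < t) (f g : ℝ × ℝ) :
    lineEval (diagonal s t f g) t = lineEval g t :=
  lineEval_lineThrough_right (p := ![s, lineEval f s, 0]) (q := ![t, lineEval g t, 0]) hst.ne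

/-- The lower boundary of the half of a trapezoid below (`false`) or above (`true`) the
diagonal. -/
noncomputable def halfLower (s t : ℝ) (f g : ℝ × ℝ) : Bool → ℝ × ℝ
  | false => f
  | true => diagonal s t f g

/-- The upper boundary of the half of a trapezoid below (`false`) or above (`true`) the
diagonal. -/
noncomputable def halfUpper (s t : ℝ) (f g : ℝ × ℝ) : Bool → ℝ × ℝ
  | false => diagonal s t f g
  | true => g

/-- The half of a trapezoid below (`false`) or above (`true`) the diagonal. -/
noncomputable def half (π : ℝ × ℝ × ℝ) (s t : ℝ) (f g : ℝ × ℝ) (b : Bool) : Set (Fin 3 → ℝ) :=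
  trapezoid π s t (halfLower s t f g b) (halfUpper s t f g b)

/-- The half of a trapezoid on the side `b` of the diagonal is two-dimensional. -/
def HalfNondegenerate (s t : ℝ) (f g : ℝ × ℝ) : Bool → Prop
  | false => lineEval f t < lineEval g t
  | true => lineEval f s < lineEval g s

section Halves

variable {π : ℝ × ℝ × ℝ} {s t : ℝ} {f g : ℝ × ℝ} {b : Bool}

lemma half_ends (hst : s < t) (hb : HalfNondegenerate s t f g b) :
    (lineEval (halfLower s t f g b) s = lineEval (halfUpper s t f g b) s ∧
        lineEval (halfLower s t f g b) t < lineEval (halfUpper s t f g b) t) ∨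
      (lineEval (halfLower s t f g b) s < lineEval (halfUpper s t f g b) s ∧
        lineEval (halfLower s t f g b) t = lineEval (halfUpper s t f g b) t) := by
  cases b <;> simp only [HalfNondegenerate] at hb <;>
    simp [halfLower, halfUpper, lineEval_diagonal_left, lineEval_diagonal_right hst, hb]

lemma isTriangleSet_half (hst : s < t) (hb : HalfNondegenerate s t f g b) :
    IsTriangleSet (half π s t f g b) :=
  isTriangleSet_trapezoid π hst (half_ends hst hb)

lemma intrinsicInterior_half_subset (hst : s < t) (hb : HalfNondegenerate s t f g b)
    {p : Fin 3 → ℝ} (hp : p ∈ intrinsicInterior ℝ (half π s t f g b)) :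
    p 0 ∈ Set.Ioo s t ∧ lineEval (halfLower s t f g b) (p 0) < p 1 ∧
      p 1 < lineEval (halfUpper s t f g b) (p 0) := by
  have h := half_ends hst hb
  exact intrinsicInterior_trapezoid_subset hst (fun x hx =>
    lineEval_lt_of_mem_Ioo (h.elim (fun h => h.1.le) (fun h => h.1.le))
      (h.elim (fun h => h.2.le) (fun h => h.2.le)) (h.symm.imp And.left And.right) hx) hp

lemma half_subset (hst : s < t) (hfg : ∀ x ∈ Set.Ioo s t, lineEval f x < lineEval g x) :
    half π s t f g b ⊆ trapezoid π s t f g := by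
  obtain ⟨hs, ht⟩ := lineEval_le_ends hst hfg
  rintro p ⟨h1, h2, h3, h4, h5⟩
  refine ⟨h1, h2, le_trans ?_ h3, h4.trans ?_, h5⟩
  · cases b
    · exact le_rfl
    · exact lineEval_le_of_mem_Icc (by simp [halfLower, lineEval_diagonal_left])
        (by simpa [halfLower, lineEval_diagonal_right hst] using ht) ⟨h1, h2⟩
  · cases b
    · exact lineEval_le_of_mem_Icc (by simpa [halfUpper, lineEval_diagonal_left] using hs)
        (by simp [halfUpper, lineEval_diagonal_right hst]) ⟨h1, h2⟩
    · exact le_rfl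

/-- The two-dimensional halves of a trapezoid cover it. -/
lemma exists_mem_half (hst : s < t) (hfg : ∀ x ∈ Set.Ioo s t, lineEval f x < lineEval g x)
    {p : Fin 3 → ℝ} (hp : p ∈ trapezoid π s t f g) :
    ∃ b, HalfNondegenerate s t f g b ∧ p ∈ half π s t f g b := by
  obtain ⟨hs, ht⟩ := lineEval_le_ends hst hfg
  obtain ⟨h1, h2, h3, h4, h5⟩ := hp
  have hd1 := lineEval_diagonal_left s t f g
  have hd2 := lineEval_diagonal_right hst f g
  rcases hs.eq_or_lt with hs' | hs'
  · have htlt : lineEval f t < lineEval g t := by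
      refine ht.lt_of_ne fun ht' => ?_
      have hmem : (s + t) / 2 ∈ Set.Ioo s t := ⟨by linarith, by linarith⟩
      exact (hfg _ hmem).not_ge (lineEval_le_of_mem_Icc hs'.ge ht'.ge (Set.Ioo_subset_Icc_self hmem))
    refine ⟨false, htlt, h1, h2, h3, h4.trans ?_, h5⟩
    exact lineEval_le_of_mem_Icc (by simp [halfUpper, hd1, hs']) (by simp [halfUpper, hd2]) ⟨h1, h2⟩
  rcases ht.eq_or_lt with ht' | ht'
  · refine ⟨true, hs', h1, h2, le_trans ?_ h3, h4, h5⟩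
    exact lineEval_le_of_mem_Icc (by simp [halfLower, hd1]) (by simp [halfLower, hd2, ht']) ⟨h1, h2⟩
  rcases le_total (p 1) (lineEval (diagonal s t f g) (p 0)) with h | h
  · exact ⟨false, ht', h1, h2, h3, h, h5⟩
  · exact ⟨true, hs', h1, h2, h, h4, h5⟩

end Halves

lemma exists_lines_of_separated {π : ℝ × ℝ × ℝ} {a b c : Fin 3 → ℝ} {s t : ℝ} {L : Set (ℝ × ℝ)}
    (hst : s < t) (hD : (b 0 - a 0) * (c 1 - a 1) - (b 1 - a 1) * (c 0 - a 0) ≠ 0)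
    (ha : a 2 = planeEval π (a 0) (a 1)) (hb : b 2 = planeEval π (b 0) (b 1))
    (hc : c 2 = planeEval π (c 0) (c 1))
    (hsep : (a 0 ≤ s ∧ t ≤ b 0 ∧ t ≤ c 0) ∨ (b 0 ≤ s ∧ c 0 ≤ s ∧ t ≤ a 0))
    (hab : lineThrough a b ∈ L) (hac : lineThrough a c ∈ L) :
    ∃ f ∈ L, ∃ g ∈ L, (∀ x ∈ Set.Ioo s t, lineEval f x < lineEval g x) ∧
      convexHull ℝ {a, b, c} ∩ {p | s ≤ p 0 ∧ p 0 ≤ t} = trapezoid π s t f g := by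
  have hb0 : a 0 ≠ b 0 := by rcases hsep with h | h <;> intro <;> linarith
  have hc0 : a 0 ≠ c 0 := by rcases hsep with h | h <;> intro <;> linarith
  have hb1 := lineEval_lineThrough_right hb0
  have hc1 := lineEval_lineThrough_right hc0
  have ha1 := lineEval_lineThrough_left a b
  have ha2 := lineEval_lineThrough_left a c
  obtain ⟨E, hE⟩ : ∃ E, E = (lineThrough a c).1 - (lineThrough a b).1 := ⟨_, rfl⟩
  have hdiff : ∀ x, lineEval (lineThrough a c) x - lineEval (lineThrough a b) x =
      E * (x - a 0) := by
    intro x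
    simp only [lineEval] at *
    linear_combination ha2 - ha1 - (x - a 0) * hE
  have hE0 : E ≠ 0 := by
    intro h0
    have h1 := hdiff (b 0)
    have h2 := hdiff (c 0)
    apply hD
    simp only [lineEval] at *
    rw [h0] at hE h1 h2
    linear_combination (b 0 - a 0) * (ha2 - hc1) + (c 0 - a 0) * (hb1 - ha1) -
      (b 0 - a 0) * (c 0 - a 0) * hE
  have hsgn : (∀ x ∈ Set.Ioo s t, 0 < E * (x - a 0)) ∨ (∀ x ∈ Set.Ioo s t, E * (x - a 0) < 0) := by
    rcases hE0.lt_or_gt with hE' | hE' <;> rcases hsep with h | h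
    · exact Or.inr fun x hx => mul_neg_of_neg_of_pos hE' (by linarith [hx.1])
    · exact Or.inl fun x hx => mul_pos_of_neg_of_neg hE' (by linarith [hx.2])
    · exact Or.inl fun x hx => mul_pos hE' (by linarith [hx.1])
    · exact Or.inr fun x hx => mul_neg_of_pos_of_neg hE' (by linarith [hx.2])
  rcases hsgn with h | h
  · have hfg : ∀ x ∈ Set.Ioo s t, lineEval (lineThrough a b) x < lineEval (lineThrough a c) x :=
      fun x hx => by linarith [h x hx, hdiff x]
    exact ⟨_, hab, _, hac, hfg, convexHull_inter_slab hst ha1 ha2 hb1 hc1 ha hb hc hsep hfg⟩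
  · have hfg : ∀ x ∈ Set.Ioo s t, lineEval (lineThrough a c) x < lineEval (lineThrough a b) x :=
      fun x hx => by linarith [h x hx, hdiff x]
    refine ⟨_, hac, _, hab, hfg, ?_⟩
    rw [Set.pair_comm]
    exact convexHull_inter_slab hst ha2 ha1 hc1 hb1 ha hc hb (by tauto) hfg

/-- Over a slab without vertices in its interior, a triangle is a trapezoid between two of its
edge lines. -/
lemma exists_lines {π : ℝ × ℝ × ℝ} {v : Fin 3 → Fin 3 → ℝ} {s t : ℝ} {L : Set (ℝ × ℝ)}
    (hst : s < t)
    (hD : (v 1 0 - v 0 0) * (v 2 1 - v 0 1) - (v 1 1 - v 0 1) * (v 2 0 - v 0 0) ≠ 0)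
    (hπ : ∀ i, v i 2 = planeEval π (v i 0) (v i 1)) (hL : ∀ i j, lineThrough (v i) (v j) ∈ L)
    (hslab : ∀ i, v i 0 ≤ s ∨ t ≤ v i 0) (hmin : ∃ i, v i 0 ≤ s) (hmax : ∃ i, t ≤ v i 0) :
    ∃ f ∈ L, ∃ g ∈ L, (∀ x ∈ Set.Ioo s t, lineEval f x < lineEval g x) ∧
      convexHull ℝ {v 0, v 1, v 2} ∩ {p | s ≤ p 0 ∧ p 0 ≤ t} = trapezoid π s t f g := by
  have hsep : ∃ i j k, ({v i, v j, v k} : Set (Fin 3 → ℝ)) = {v 0, v 1, v 2} ∧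
      (v j 0 - v i 0) * (v k 1 - v i 1) - (v j 1 - v i 1) * (v k 0 - v i 0) ≠ 0 ∧
      ((v i 0 ≤ s ∧ t ≤ v j 0 ∧ t ≤ v k 0) ∨ (v j 0 ≤ s ∧ v k 0 ≤ s ∧ t ≤ v i 0)) := by
    have e1 : ({v 1, v 0, v 2} : Set (Fin 3 → ℝ)) = {v 0, v 1, v 2} := Set.insert_comm _ _ _
    have e2 : ({v 2, v 0, v 1} : Set (Fin 3 → ℝ)) = {v 0, v 1, v 2} := by
      rw [Set.insert_comm, Set.pair_comm (v 2)]
    have d1 : (v 0 0 - v 1 0) * (v 2 1 - v 1 1) - (v 0 1 - v 1 1) * (v 2 0 - v 1 0) ≠ 0 :=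
      fun h => hD (by linear_combination -h)
    have d2 : (v 0 0 - v 2 0) * (v 1 1 - v 2 1) - (v 0 1 - v 2 1) * (v 1 0 - v 2 0) ≠ 0 :=
      fun h => hD (by linear_combination h)
    have hnot : ∀ i, ¬ (v i 0 ≤ s ∧ t ≤ v i 0) := fun i h => by linarith [h.1, h.2]
    have n0 := hnot 0
    have n1 := hnot 1
    have n2 := hnot 2
    rcases hslab 0 with h0 | h0 <;> rcases hslab 1 with h1 | h1 <;> rcases hslab 2 with h2 | h2
    · exfalso
      obtain ⟨i, hi⟩ := hmax
      fin_cases i <;> tauto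
    · exact ⟨2, 0, 1, e2, d2, by tauto⟩
    · exact ⟨1, 0, 2, e1, d1, by tauto⟩
    · exact ⟨0, 1, 2, rfl, hD, by tauto⟩
    · exact ⟨0, 1, 2, rfl, hD, by tauto⟩
    · exact ⟨1, 0, 2, e1, d1, by tauto⟩
    · exact ⟨2, 0, 1, e2, d2, by tauto⟩
    · exfalso
      obtain ⟨i, hi⟩ := hmin
      fin_cases i <;> tauto
  obtain ⟨i, j, k, hset, hdet, hsep⟩ := hsep
  rw [← hset]
  exact exists_lines_of_separated hst hdet (hπ i) (hπ j) (hπ k) hsep (hL i j) (hL i k)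

/-- Two elements of `X` with no element of `X` strictly between them. -/
def Consecutive (X : Finset ℝ) (s t : ℝ) : Prop :=
  s ∈ X ∧ t ∈ X ∧ s < t ∧ ∀ u ∈ X, ¬ (s < u ∧ u < t)

lemma Consecutive.eq_of_mem_Ioo {X : Finset ℝ} {s t s' t' x : ℝ} (h : Consecutive X s t)
    (h' : Consecutive X s' t') (hx : x ∈ Set.Ioo s t) (hx' : x ∈ Set.Ioo s' t') :
    s = s' ∧ t = t' := by
  obtain ⟨hs, ht, -, hX⟩ := h
  obtain ⟨hs', ht', -, hX'⟩ := h'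
  obtain ⟨h1, h2⟩ := hx
  obtain ⟨h3, h4⟩ := hx'
  constructor
  · rcases lt_trichotomy s s' with h | h | h
    · exact absurd ⟨h, h3.trans h2⟩ (hX _ hs')
    · exact h
    · exact absurd ⟨h, h1.trans h4⟩ (hX' _ hs)
  · rcases lt_trichotomy t t' with h | h | h
    · exact absurd ⟨h3.trans h2, h⟩ (hX' _ ht)
    · exact h
    · exact absurd ⟨h1.trans h4, h⟩ (hX _ ht')

lemma Consecutive.right_unique {X : Finset ℝ} {s t t' : ℝ} (h : Consecutive X s t)
    (h' : Consecutive X s t') : t = t' := by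
  have hst := h.2.2.1
  have hst' := h'.2.2.1
  obtain ⟨x, hx, hx'⟩ := exists_between (lt_min hst hst')
  exact (h.eq_of_mem_Ioo h' ⟨hx, hx'.trans_le (min_le_left _ _)⟩
    ⟨hx, hx'.trans_le (min_le_right _ _)⟩).2

lemma exists_consecutive {X : Finset ℝ} {A B x : ℝ} (hA : A ∈ X) (hB : B ∈ X) (hAB : A < B)
    (hx : x ∈ Set.Icc A B) : ∃ s t, Consecutive X s t ∧ A ≤ s ∧ s ≤ x ∧ x ≤ t ∧ t ≤ B := by
  obtain ⟨hAx, hxB⟩ := hx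
  rcases hAx.eq_or_lt with rfl | hAx
  · obtain ⟨t, ht, hmin⟩ := Finset.exists_min_image (X.filter (A < ·)) id
      ⟨B, by simp [hB, hAB]⟩
    simp only [Finset.mem_filter, id] at ht hmin
    exact ⟨A, t, ⟨hA, ht.1, ht.2, fun u hu h => (hmin u ⟨hu, h.1⟩).not_gt h.2⟩, le_rfl, le_rfl,
      ht.2.le, hmin B ⟨hB, hAB⟩⟩
  · obtain ⟨s, hs, hmax⟩ := Finset.exists_max_image (X.filter (· < x)) id
      ⟨A, by simp [hA, hAx]⟩
    obtain ⟨t, ht, hmin⟩ := Finset.exists_min_image (X.filter (x ≤ ·)) id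
      ⟨B, by simp [hB, hxB]⟩
    simp only [Finset.mem_filter, id] at hs hmax ht hmin
    refine ⟨s, t, ⟨hs.1, ht.1, hs.2.trans_le ht.2, fun u hu h => ?_⟩, hmax A ⟨hA, hAx⟩, hs.2.le,
      ht.2, hmin B ⟨hB, hxB⟩⟩
    rcases lt_or_ge u x with hux | hux
    · exact (hmax u ⟨hu, hux⟩).not_gt h.1
    · exact (hmin u ⟨hu, hux⟩).not_gt h.2

/-- The `x`-coordinate at which two lines cross; a junk value if they are parallel. -/
noncomputable def crossing (f g : ℝ × ℝ) : ℝ := (g.2 - f.2) / (f.1 - g.1)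

/-- Two lines do not change their order over an interval containing no crossing. -/
lemma lineEval_le_of_crossing_notMem {f g : ℝ × ℝ} {s t x y : ℝ}
    (h : crossing f g ∉ Set.Ioo s t) (hx : x ∈ Set.Ioo s t) (hy : y ∈ Set.Ioo s t)
    (hfg : lineEval f x ≤ lineEval g x) : lineEval f y ≤ lineEval g y := by
  by_contra! hc
  have hne : f.1 - g.1 ≠ 0 := by
    intro h0
    have : f.1 = g.1 := sub_eq_zero.1 h0
    simp only [lineEval, this] at hc hfg
    linarith
  have hdiff : ∀ z, lineEval f z - lineEval g z = (f.1 - g.1) * (z - crossing f g) := by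
    intro z
    simp only [lineEval, crossing]
    field_simp
    ring
  have h1 : (f.1 - g.1) * (x - crossing f g) ≤ 0 := by linarith [hdiff x]
  have h2 : 0 < (f.1 - g.1) * (y - crossing f g) := by linarith [hdiff y]
  apply h
  obtain ⟨hx1, hx2⟩ := hx
  obtain ⟨hy1, hy2⟩ := hy
  rcases hne.lt_or_gt with h0 | h0
  · have := (neg_iff_neg_of_mul_pos h2).1 h0
    have := nonneg_of_mul_nonpos_right h1 h0
    exact ⟨by linarith, by linarith⟩
  · have := (pos_iff_pos_of_mul_pos h2).1 h0
    have := nonpos_of_mul_nonpos_right h1 h0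
    exact ⟨by linarith, by linarith⟩

/-- Disjoint trapezoids over the same slab have the same vertical order over all common points
of their projections. -/
lemma planeEval_lt_of_disjoint {π π' : ℝ × ℝ × ℝ} {s t : ℝ} {f g f' g' : ℝ × ℝ}
    (hdisj : Disjoint (trapezoid π s t f g) (trapezoid π' s t f' g')) {x y x' y' : ℝ}
    (hx : x ∈ Set.Icc s t) (hy : y ∈ Set.Icc (lineEval f x) (lineEval g x))
    (hy₁ : y ∈ Set.Icc (lineEval f' x) (lineEval g' x))
    (hx' : x' ∈ Set.Icc s t) (hy' : y' ∈ Set.Icc (lineEval f x') (lineEval g x'))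
    (hy₁' : y' ∈ Set.Icc (lineEval f' x') (lineEval g' x'))
    (hlt : planeEval π x y < planeEval π' x y) : planeEval π x' y' < planeEval π' x' y' := by
  by_contra! hc
  obtain ⟨h0, hh0⟩ : ∃ h0, h0 = planeEval π' x y - planeEval π x y := ⟨_, rfl⟩
  obtain ⟨h1, hh1⟩ : ∃ h1, h1 = planeEval π x' y' - planeEval π' x' y' := ⟨_, rfl⟩
  have hpos : 0 < h0 := by linarith
  have hnonneg : 0 ≤ h1 := by linarith
  obtain ⟨u, w, hu, hw, huw, huw'⟩ : ∃ u w : ℝ, 0 ≤ u ∧ 0 ≤ w ∧ u + w = 1 ∧ u * h0 = w * h1 :=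
    ⟨h1 / (h0 + h1), h0 / (h0 + h1), by positivity, by positivity, by field_simp; ring,
      by ring⟩
  have hline : ∀ l : ℝ × ℝ, lineEval l (u * x + w * x') = u * lineEval l x + w * lineEval l x' := by
    intro l
    simp only [lineEval]
    linear_combination -l.2 * huw
  have hplane : ∀ l : ℝ × ℝ × ℝ, planeEval l (u * x + w * x') (u * y + w * y') =
      u * planeEval l x y + w * planeEval l x' y' := by
    intro l
    simp only [planeEval]
    linear_combination -l.2.2 * huw
  have hX : u * x + w * x' ∈ Set.Icc s t := convex_Icc s t hx hx' hu hw huw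
  have hmono : ∀ {a b c d : ℝ}, a ≤ b → c ≤ d → u * a + w * c ≤ u * b + w * d := fun h h' =>
    add_le_add (mul_le_mul_of_nonneg_left h hu) (mul_le_mul_of_nonneg_left h' hw)
  refine Set.disjoint_left.1 hdisj
    (show (![u * x + w * x', u * y + w * y', planeEval π (u * x + w * x') (u * y + w * y')] :
      Fin 3 → ℝ) ∈ trapezoid π s t f g from ⟨hX.1, hX.2, ?_, ?_, rfl⟩) ⟨hX.1, hX.2, ?_, ?_, ?_⟩
  · exact (hline f).trans_le (hmono hy.1 hy'.1)
  · exact (hmono hy.2 hy'.2).trans_eq (hline g).symm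
  · exact (hline f').trans_le (hmono hy₁.1 hy₁'.1)
  · exact (hmono hy₁.2 hy₁'.2).trans_eq (hline g').symm
  · change planeEval π (u * x + w * x') (u * y + w * y') =
      planeEval π' (u * x + w * x') (u * y + w * y')
    rw [hplane, hplane]
    linear_combination u * hh0 - w * hh1 - huw'

/-- An irreflexive relation that is transitive through key-minimal elements has no cycles. -/
lemma not_transGen_self_of_key {ι : Type*} {R : ι → ι → Prop} (key : ι → ℝ)
    (hirr : ∀ a, ¬ R a a)
    (htrans : ∀ a b c, R a b → R b c → key b ≤ key a → key b ≤ key c → R a c)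
    (S : Finset ι) (a : ι) :
    ¬ Relation.TransGen (fun x y => x ∈ S ∧ y ∈ S ∧ R x y) a a := by
  classical
  induction S using Finset.strongInduction generalizing a with
  | H S ih =>
    intro hcyc
    have haS : a ∈ S := by
      obtain ⟨b, hb, -⟩ := Relation.TransGen.head'_iff.1 hcyc
      exact hb.1
    obtain ⟨m, hm, hmin⟩ := S.exists_min_image key ⟨a, haS⟩
    have bypass : ∀ {x y}, x ≠ m → Relation.TransGen (fun x y => x ∈ S ∧ y ∈ S ∧ R x y) x y →
        (y ≠ m → Relation.TransGen
          (fun x y => x ∈ S.erase m ∧ y ∈ S.erase m ∧ R x y) x y) ∧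
        (y = m → ∃ z ∈ S.erase m, Relation.ReflTransGen
          (fun x y => x ∈ S.erase m ∧ y ∈ S.erase m ∧ R x y) x z ∧ R z m) := by
      intro x y hx hxy
      induction hxy with
      | single h =>
        refine ⟨fun hy => .single ⟨Finset.mem_erase.2 ⟨hx, h.1⟩, Finset.mem_erase.2 ⟨hy, h.2.1⟩,
          h.2.2⟩, ?_⟩
        rintro rfl
        exact ⟨x, Finset.mem_erase.2 ⟨hx, h.1⟩, .refl, h.2.2⟩
      | @tail b c _ h ihb =>
        by_cases hb : b = m
        · obtain ⟨z, hz, hxz, hzm⟩ := ihb.2 hb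
          subst hb
          refine ⟨fun hc => .tail' hxz ⟨hz, Finset.mem_erase.2 ⟨hc, h.2.1⟩, ?_⟩, ?_⟩
          · exact htrans _ _ _ hzm h.2.2 (hmin _ (Finset.mem_of_mem_erase hz)) (hmin _ h.2.1)
          · rintro rfl
            exact absurd h.2.2 (hirr _)
        · have hb' : b ∈ S.erase m := Finset.mem_erase.2 ⟨hb, h.1⟩
          refine ⟨fun hc => .tail (ihb.1 hb) ⟨hb', Finset.mem_erase.2 ⟨hc, h.2.1⟩, h.2.2⟩, ?_⟩
          rintro rfl
          exact ⟨b, hb', (ihb.1 hb).to_reflTransGen, h.2.2⟩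
    have hno : ∀ x, x ≠ m → ¬ Relation.TransGen (fun x y => x ∈ S ∧ y ∈ S ∧ R x y) x x :=
      fun x hx h => ih _ (Finset.erase_ssubset hm) x ((bypass hx h).1 hx)
    by_cases ha : a = m
    · obtain ⟨b, hb, hba⟩ := Relation.TransGen.head'_iff.1 hcyc
      refine hno b ?_ (.tail' hba hb)
      rintro rfl
      exact hirr _ (ha ▸ hb.2.2)
    · exact hno a ha hcyc

lemma not_cyclic_of_key {k : ℕ} {R : Fin (k + 1) → Fin (k + 1) → Prop} (key : Fin (k + 1) → ℝ)
    (hirr : ∀ a, ¬ R a a)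
    (htrans : ∀ a b c, R a b → R b c → key b ≤ key a → key b ≤ key c → R a c) :
    ¬ ∀ i, R i (i + 1) := by
  intro h
  have hchain : ∀ j : ℕ, Relation.TransGen
      (fun x y => x ∈ Finset.univ ∧ y ∈ Finset.univ ∧ R x y) 0 (Fin.ofNat (k + 1) (j + 1)) := by
    intro j
    induction j with
    | zero =>
      refine .single ⟨Finset.mem_univ _, Finset.mem_univ _, ?_⟩
      convert h 0 using 1
      simp [Fin.ext_iff]
    | succ j ih =>
      refine ih.tail ⟨Finset.mem_univ _, Finset.mem_univ _, ?_⟩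
      convert h _ using 1
      simp [Fin.ext_iff, Fin.val_add]
  have := hchain k
  rw [show Fin.ofNat (k + 1) (k + 1) = 0 by simp] at this
  exact not_transGen_self_of_key key hirr htrans Finset.univ 0 this

/-- Over each slab the depth order is that of the cross-section, where the segment ending first
can be bypassed in any cycle. -/
lemma depthAcyclic_of_trapezoids {ι κ : Type*} {X : Finset ℝ} {T : κ → Set (Fin 3 → ℝ)}
    (hT : ∀ i j, i ≠ j → Disjoint (T i) (T j)) (owner : ι → κ) (π : κ → ℝ × ℝ × ℝ) (s t : ι → ℝ)
    (f g : ι → ℝ × ℝ) (piece : ι → Set (Fin 3 → ℝ)) (hX : ∀ j, Consecutive X (s j) (t j))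
    (hcross : ∀ j j', crossing (f j) (g j') ∈ X)
    (htrap : ∀ j, trapezoid (π (owner j)) (s j) (t j) (f j) (g j) ⊆ T (owner j))
    (hpiece : ∀ j, ∀ p ∈ intrinsicInterior ℝ (piece j), p 0 ∈ Set.Ioo (s j) (t j) ∧
      p ∈ trapezoid (π (owner j)) (s j) (t j) (f j) (g j)) :
    DepthAcyclic {o | ∃ j, o = intrinsicInterior ℝ (piece j)} := by
  rintro ⟨k, o, ho, hcyc⟩
  choose j hj using ho
  let mid : ι → ℝ := fun j => (s j + t j) / 2
  have hmid : ∀ j, mid j ∈ Set.Ioo (s j) (t j) := fun j => by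
    have := (hX j).2.2.1
    constructor <;> simp only [mid] <;> linarith
  let R : ι → ι → Prop := fun a b => s a = s b ∧ t a = t b ∧
    ∃ y, y ∈ Set.Icc (lineEval (f a) (mid a)) (lineEval (g a) (mid a)) ∧
      y ∈ Set.Icc (lineEval (f b) (mid a)) (lineEval (g b) (mid a)) ∧
      planeEval (π (owner a)) (mid a) y < planeEval (π (owner b)) (mid a) y
  have hmono : ∀ {a b x y x' y'}, s a = s b → t a = t b → x ∈ Set.Icc (s a) (t a) →
      y ∈ Set.Icc (lineEval (f a) x) (lineEval (g a) x) →
      y ∈ Set.Icc (lineEval (f b) x) (lineEval (g b) x) → x' ∈ Set.Icc (s a) (t a) →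
      y' ∈ Set.Icc (lineEval (f a) x') (lineEval (g a) x') →
      y' ∈ Set.Icc (lineEval (f b) x') (lineEval (g b) x') →
      planeEval (π (owner a)) x y < planeEval (π (owner b)) x y →
      planeEval (π (owner a)) x' y' < planeEval (π (owner b)) x' y' := by
    intro a b x y x' y' hs ht hx hy hy₁ hx' hy' hy₁' hlt
    refine planeEval_lt_of_disjoint ?_ hx hy hy₁ hx' hy' hy₁' hlt
    refine (hT (owner a) (owner b) fun h => ?_).mono (htrap a) (hs ▸ ht ▸ htrap b)
    rw [h] at hlt
    exact hlt.false
  refine not_cyclic_of_key (R := fun a b => R (j a) (j b))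
    (fun a => lineEval (g (j a)) (mid (j a))) ?_ ?_ fun i => ?_
  · rintro a ⟨-, -, y, -, -, h⟩
    exact h.false
  · rintro a b c ⟨hs, ht, y, hya, hyb, hab⟩ ⟨hs', ht', z, hzb, hzc, hbc⟩ hba hbc'
    have e1 : mid (j a) = mid (j b) := by simp only [mid, hs, ht]
    have e2 : mid (j c) = mid (j b) := by simp only [mid, hs', ht']
    have hm := Set.Ioo_subset_Icc_self (hmid (j b))
    simp only [e1, e2] at hba hbc' hya hyb hab
    have hwa := Set.mem_Icc.2 ⟨hya.1.trans hyb.2, hba⟩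
    have hwb := Set.mem_Icc.2 ⟨hyb.1.trans hyb.2, le_rfl⟩
    have hwc := Set.mem_Icc.2 ⟨hzc.1.trans hzb.2, hbc'⟩
    refine ⟨hs.trans hs', ht.trans ht', lineEval (g (j b)) (mid (j b)), ?_, ?_, ?_⟩
    · rwa [e1]
    · rwa [e1]
    · rw [e1]
      exact (hmono hs ht (hs ▸ ht ▸ hm) hya hyb (hs ▸ ht ▸ hm) hwa hwb hab).trans
        (hmono hs' ht' hm hzb hzc hm hwb hwc hbc)
  · obtain ⟨p, hp, q, hq, h0, h1, h2⟩ := hcyc i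
    rw [hj] at hp hq
    generalize j (i + 1) = b at *
    generalize j i = a at *
    obtain ⟨hpx, -, -, hp1, hp2, hp3⟩ := hpiece _ p hp
    obtain ⟨hqx, -, -, hq1, hq2, hq3⟩ := hpiece _ q hq
    rw [hp3, hq3, h0, h1] at h2
    rw [h0] at hpx
    rw [h0, h1] at hp1 hp2
    obtain ⟨hs, ht⟩ := (hX a).eq_of_mem_Ioo (hX b) hpx hqx
    have hnot : ∀ {c d}, crossing (f c) (g d) ∉ Set.Ioo (s a) (t a) := fun h =>
      (hX a).2.2.2 _ (hcross _ _) h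
    have haa := lineEval_le_of_crossing_notMem hnot hpx (hmid a) (hp1.trans hp2)
    have hab := lineEval_le_of_crossing_notMem hnot hpx (hmid a) (hp1.trans hq2)
    have hba := lineEval_le_of_crossing_notMem hnot hpx (hmid a) (hq1.trans hp2)
    have hbb := lineEval_le_of_crossing_notMem hnot hpx (hmid a) (hq1.trans hq2)
    have hya := Set.mem_Icc.2 ⟨le_max_left (lineEval (f a) (mid a)) (lineEval (f b) (mid a)),
      max_le haa hba⟩
    have hyb := Set.mem_Icc.2 ⟨le_max_right (lineEval (f a) (mid a)) (lineEval (f b) (mid a)),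
      max_le hab hbb⟩
    exact ⟨hs, ht, _, hya, hyb, hmono hs ht (Set.Ioo_subset_Icc_self hpx) ⟨hp1, hp2⟩ ⟨hq1, hq2⟩
      (Set.Ioo_subset_Icc_self (hmid a)) hya hyb h2⟩

/-- **the naive cubic decomposition.** There is an absolute constant `C`
such that any `n` pairwise disjoint non-vertical triangles in general position can each be
partitioned into closed triangular pieces with pairwise disjoint relative interiors, at
most `C·n³` pieces in total, so that the depth relation on the relative interiors of the
pieces is acyclic. Here the triangle `i` has vertices `v i 0, v i 1, v i 2`, and general
position means: no two projected edges of distinct triangles overlap, no vertex projects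
into a projected edge of another triangle, and no three projected edges of three distinct
triangles are concurrent. -/
theorem naive_cubic_decomposition :
    ∃ C : ℕ, 0 < C ∧
      ∀ (n : ℕ) (v : Fin n → Fin 3 → (Fin 3 → ℝ))
        (T : Fin n → Set (Fin 3 → ℝ)),
        (∀ i, T i = convexHull ℝ {v i 0, v i 1, v i 2}) →
        (∀ i, AffineIndependent ℝ (v i)) →
        -- non-vertical:
        (∀ i, (![0, 0, 1] : Fin 3 → ℝ) ∉
            (affineSpan ℝ ({v i 0, v i 1, v i 2} : Set (Fin 3 → ℝ))).direction) →
        -- pairwise disjoint: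
        (∀ i j, i ≠ j → Disjoint (T i) (T j)) →
        -- general position: no two projected edges of distinct triangles overlap
        (∀ i j, i ≠ j → ∀ a b c d : Fin 3, a ≠ b → c ≠ d →
          (segment ℝ (proj (v i a)) (proj (v i b)) ∩
            segment ℝ (proj (v j c)) (proj (v j d))).Subsingleton) →
        -- no vertex projects onto a projected edge of another triangle
        (∀ i j, i ≠ j → ∀ a c d : Fin 3, c ≠ d →
          proj (v i a) ∉ segment ℝ (proj (v j c)) (proj (v j d))) →
        -- no three projected edges of three distinct triangles are concurrent
        (∀ i j k, i ≠ j → j ≠ k → i ≠ k →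
          ∀ a b c d e g : Fin 3, a ≠ b → c ≠ d → e ≠ g →
          segment ℝ (proj (v i a)) (proj (v i b)) ∩
            segment ℝ (proj (v j c)) (proj (v j d)) ∩
            segment ℝ (proj (v k e)) (proj (v k g)) = ∅) →
        ∃ (m : ℕ) (piece : Fin m → Set (Fin 3 → ℝ)) (owner : Fin m → Fin n),
          m ≤ C * n ^ 3 ∧
          (∀ p, IsTriangleSet (piece p)) ∧
          (∀ p q, p ≠ q → Disjoint (intrinsicInterior ℝ (piece p))
                                   (intrinsicInterior ℝ (piece q))) ∧
          (∀ i, T i = ⋃ p ∈ {p | owner p = i}, piece p) ∧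
          DepthAcyclic {s | ∃ p, s = intrinsicInterior ℝ (piece p)} := by
  classical
  refine ⟨168, by norm_num, ?_⟩
  intro n v T hTconv hAff hvert hdisj _ _ _
  have hD := fun i => det_ne_zero_of_nonvertical (hAff i) (hvert i)
  choose π hπ using fun i => exists_plane (hD i)
  let L : Finset (ℝ × ℝ) := Finset.univ.image
    fun e : Fin n × Fin 3 × Fin 3 => lineThrough (v e.1 e.2.1) (v e.1 e.2.2)
  let X : Finset ℝ := (Finset.univ.image fun e : Fin n × Fin 3 => v e.1 e.2 0) ∪
    (L ×ˢ L).image fun e => crossing e.1 e.2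
  have hvX : ∀ i a, v i a 0 ∈ X := fun i a =>
    Finset.mem_union_left _ (Finset.mem_image_of_mem _ (Finset.mem_univ (i, a)))
  have hLX : ∀ f ∈ L, ∀ g ∈ L, crossing f g ∈ X := fun f hf g hg => Finset.mem_union_right _
    (Finset.mem_image_of_mem (fun e : (ℝ × ℝ) × ℝ × ℝ => crossing e.1 e.2)
      (Finset.mk_mem_product hf hg))
  have hXcard : X.card ≤ 3 * n + 81 * n ^ 2 := by
    have hL : L.card ≤ 9 * n := Finset.card_image_le.trans (by simp; omega)
    have h1 : (Finset.univ.image fun e : Fin n × Fin 3 => v e.1 e.2 0).card ≤ 3 * n :=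
      Finset.card_image_le.trans (by simp; omega)
    have h2 : ((L ×ˢ L).image fun e => crossing e.1 e.2).card ≤ L.card * L.card :=
      Finset.card_image_le.trans (Finset.card_product _ _).le
    have h3 := Nat.mul_le_mul hL hL
    have h4 := Finset.card_union_le (Finset.univ.image fun e : Fin n × Fin 3 => v e.1 e.2 0)
      ((L ×ˢ L).image fun e => crossing e.1 e.2)
    calc X.card ≤ _ := h4
      _ ≤ 3 * n + 9 * n * (9 * n) := by omega
      _ = _ := by ring
  let Slab : Fin n → ℝ → ℝ → Prop := fun i s t =>
    Consecutive X s t ∧ (∃ a, v i a 0 ≤ s) ∧ ∃ a, t ≤ v i a 0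
  have hlines : ∀ i s t, ∃ f g, Slab i s t → f ∈ L ∧ g ∈ L ∧
      (∀ x ∈ Set.Ioo s t, lineEval f x < lineEval g x) ∧
      T i ∩ {p | s ≤ p 0 ∧ p 0 ≤ t} = trapezoid (π i) s t f g := by
    intro i s t
    by_cases h : Slab i s t
    · have hsep : ∀ a, v i a 0 ≤ s ∨ t ≤ v i a 0 := fun a => by
        by_contra! hc
        exact h.1.2.2.2 _ (hvX i a) hc
      have hplane : ∀ a, v i a 2 = planeEval (π i) (v i a 0) (v i a 1) := fun a => by
        fin_cases a
        exacts [(hπ i).1, (hπ i).2.1, (hπ i).2.2]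
      obtain ⟨f, hf, g, hg, hfg, heq⟩ := exists_lines (L := (L : Set (ℝ × ℝ))) h.1.2.2.1 (hD i)
        hplane (fun a b => Finset.mem_coe.2 (Finset.mem_image_of_mem _ (Finset.mem_univ (i, a, b))))
        hsep h.2.1 h.2.2
      exact ⟨f, g, fun _ => ⟨hf, hg, hfg, hTconv i ▸ heq⟩⟩
    · exact ⟨0, 0, fun h' => absurd h' h⟩
  choose f g hfg using hlines
  let J : Finset (Fin n × ℝ × ℝ × Bool) := (Finset.univ ×ˢ X ×ˢ X ×ˢ Finset.univ).filter
    fun j => Slab j.1 j.2.1 j.2.2.1 ∧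
      HalfNondegenerate j.2.1 j.2.2.1 (f j.1 j.2.1 j.2.2.1) (g j.1 j.2.1 j.2.2.1) j.2.2.2
  have hJcard : J.card ≤ 168 * n ^ 3 := by
    have h1 : J.card ≤ ((Finset.univ : Finset (Fin n)) ×ˢ X ×ˢ (Finset.univ : Finset Bool)).card := by
      refine Finset.card_le_card_of_injOn (fun j => (j.1, j.2.1, j.2.2.2)) ?_ ?_
      · rintro ⟨i, s, t, b⟩ hj
        have hj := (Finset.mem_filter.1 (Finset.mem_coe.1 hj)).2
        simpa using hj.1.1.1
      · rintro ⟨i, s, t, b⟩ hj ⟨i', s', t', b'⟩ hj' h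
        have hj := (Finset.mem_filter.1 (Finset.mem_coe.1 hj)).2
        have hj' := (Finset.mem_filter.1 (Finset.mem_coe.1 hj')).2
        simp only [Prod.mk.injEq] at h
        obtain ⟨rfl, rfl, rfl⟩ := h
        obtain rfl : t = t' := hj.1.1.right_unique hj'.1.1
        rfl
    simp only [Finset.card_product, Finset.card_univ, Fintype.card_fin, Fintype.card_bool] at h1
    rcases n.eq_zero_or_pos with rfl | hn
    · simpa using h1
    · have h2 : n ≤ n ^ 2 := Nat.le_self_pow two_ne_zero n
      calc J.card ≤ n * (X.card * 2) := h1
        _ ≤ n * ((84 * n ^ 2) * 2) :=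
          Nat.mul_le_mul_left _ (Nat.mul_le_mul_right _ (hXcard.trans (by omega)))
        _ = 168 * n ^ 3 := by ring
  let idx : Fin J.card → Fin n × ℝ × ℝ × Bool := fun p => J.equivFin.symm p
  have hidx : Function.Injective idx := Subtype.val_injective.comp J.equivFin.symm.injective
  let owner : Fin J.card → Fin n := fun p => (idx p).1
  let s : Fin J.card → ℝ := fun p => (idx p).2.1
  let t : Fin J.card → ℝ := fun p => (idx p).2.2.1
  let side : Fin J.card → Bool := fun p => (idx p).2.2.2
  let F : Fin J.card → ℝ × ℝ := fun p => f (owner p) (s p) (t p)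
  let G : Fin J.card → ℝ × ℝ := fun p => g (owner p) (s p) (t p)
  let piece : Fin J.card → Set (Fin 3 → ℝ) := fun p =>
    half (π (owner p)) (s p) (t p) (F p) (G p) (side p)
  have hJ : ∀ p, Slab (owner p) (s p) (t p) ∧
      HalfNondegenerate (s p) (t p) (F p) (G p) (side p) := fun p =>
    (Finset.mem_filter.1 (J.equivFin.symm p).2).2
  have hst : ∀ p, s p < t p := fun p => (hJ p).1.1.2.2.1
  have hdata := fun p => hfg _ _ _ (hJ p).1
  have htrap : ∀ p, trapezoid (π (owner p)) (s p) (t p) (F p) (G p) ⊆ T (owner p) := fun p =>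
    (hdata p).2.2.2 ▸ Set.inter_subset_left
  have hpiece : ∀ p, piece p ⊆ trapezoid (π (owner p)) (s p) (t p) (F p) (G p) := fun p =>
    half_subset (hst p) (hdata p).2.2.1
  have hint : ∀ p, ∀ x ∈ intrinsicInterior ℝ (piece p), x 0 ∈ Set.Ioo (s p) (t p) ∧
      lineEval (halfLower (s p) (t p) (F p) (G p) (side p)) (x 0) < x 1 ∧
      x 1 < lineEval (halfUpper (s p) (t p) (F p) (G p) (side p)) (x 0) := fun p x hx =>
    intrinsicInterior_half_subset (hst p) (hJ p).2 hx
  refine ⟨J.card, piece, owner, hJcard, fun p => isTriangleSet_half (hst p) (hJ p).2, ?_, ?_, ?_⟩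
  · intro p q hpq
    rw [Set.disjoint_left]
    intro x hx hx'
    have hown : owner p = owner q := by
      by_contra h
      exact Set.disjoint_left.1 (hdisj _ _ h) (htrap p (hpiece p (intrinsicInterior_subset hx)))
        (htrap q (hpiece q (intrinsicInterior_subset hx')))
    obtain ⟨hx0, hx1, hx2⟩ := hint p x hx
    obtain ⟨hx0', hx1', hx2'⟩ := hint q x hx'
    obtain ⟨hs, ht⟩ := (hJ p).1.1.eq_of_mem_Ioo (hJ q).1.1 hx0 hx0'
    have hF : F p = F q := by simp only [F, hown, hs, ht]
    have hG : G p = G q := by simp only [G, hown, hs, ht]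
    rw [← hs, ← ht, ← hF, ← hG] at hx1' hx2'
    have hside : side p = side q := by
      cases hp : side p <;> cases hq : side q <;> simp only [hp, hq] at *
      · exact absurd (hx2.trans hx1') (lt_irrefl _)
      · exact absurd (hx2'.trans hx1) (lt_irrefl _)
    exact hpq (hidx (Prod.ext hown (Prod.ext hs (Prod.ext ht hside))))
  · intro i
    apply Set.Subset.antisymm
    · intro x hx
      obtain ⟨a, -, ha⟩ := Finset.univ.exists_min_image (fun a => v i a 0) ⟨0, Finset.mem_univ _⟩
      obtain ⟨b, -, hb⟩ := Finset.univ.exists_max_image (fun a => v i a 0) ⟨0, Finset.mem_univ _⟩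
      have ha := fun c => ha c (Finset.mem_univ c)
      have hb := fun c => hb c (Finset.mem_univ c)
      have hab : v i a 0 < v i b 0 := by
        refine lt_of_le_of_ne (ha b) fun h => hD i ?_
        have hc : ∀ c, v i c 0 = v i a 0 := fun c => le_antisymm ((hb c).trans_eq h.symm) (ha c)
        rw [hc 0, hc 1, hc 2]
        ring
      have hxab : x 0 ∈ Set.Icc (v i a 0) (v i b 0) := by
        rw [hTconv i] at hx
        obtain ⟨α, β, γ, hα, hβ, hγ, hsum, hx⟩ := mem_convexHull_triple.1 hx
        have hconv := (convex_Icc (v i a 0) (v i b 0)).sum_mem (t := Finset.univ)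
          (w := ![α, β, γ]) (z := fun c => v i c 0)
          (by intro c _; fin_cases c <;> simpa) (by simpa [Fin.sum_univ_three])
          (fun c _ => ⟨ha c, hb c⟩)
        rw [hx 0]
        simpa [Fin.sum_univ_three] using hconv
      obtain ⟨s₀, t₀, hcons, has, hsx, hxt, htb⟩ := exists_consecutive (hvX i a) (hvX i b) hab hxab
      have hslab : Slab i s₀ t₀ := ⟨hcons, ⟨a, has⟩, ⟨b, htb⟩⟩
      obtain ⟨-, -, hlt, heq⟩ := hfg _ _ _ hslab
      obtain ⟨c, hc, hxc⟩ := exists_mem_half hcons.2.2.1 hlt (heq.subset ⟨hx, hsx, hxt⟩)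
      have hmem : (i, s₀, t₀, c) ∈ J := Finset.mem_filter.2
        ⟨by simp [hcons.1, hcons.2.1], hslab, hc⟩
      have hp : idx (J.equivFin ⟨_, hmem⟩) = (i, s₀, t₀, c) := by simp [idx]
      refine Set.mem_biUnion (x := J.equivFin ⟨_, hmem⟩) ?_ ?_
      · simp only [Set.mem_ofPred_eq, owner, hp]
      · simpa only [piece, owner, s, t, F, G, side, hp] using hxc
    · refine Set.iUnion₂_subset fun p hp => ?_
      obtain rfl : owner p = i := hp
      exact (hpiece p).trans (htrap p)
  · exact depthAcyclic_of_trapezoids hdisj owner π s t F G piece (fun p => (hJ p).1.1)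
      (fun p q => hLX _ (hdata p).1 _ (hdata q).2.1) htrap
      (fun p x hx => ⟨(hint p x hx).1, hpiece p (intrinsicInterior_subset hx)⟩)
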